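/- arXiv:2604.08490 — 2 statements merged into one kernel-verified Lean document; each statement's English description precedes it below -/
import Mathlib

section
/- Let Γ be a connected, locally finite, vertex-transitive simple graph of degree d that is NOT unimodular, and let R_n denote the simple random walk on Γ started at a root o. Then the asymptotic entropy h = lim_{n→∞} H(R_n)/n exists and satisfies h ≥ −(1/2)·log(1 − 1/d²) ≥ 1/(2d²). -/
open scoped BigOperators Classical

/-- A graph is locally finite if every vertex has finitely many neighbours. -/
def LocFin {V : Type*} (Γ : SimpleGraph V) : Prop := ∀ v, (Γ.neighborSet v).Finite

/-- A graph is vertex-transitive if its automorphism group acts transitively on vertices. -/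
def VertexTransitive {V : Type*} (Γ : SimpleGraph V) : Prop :=
  ∀ u v : V, ∃ φ : Γ ≃g Γ, φ u = v

/-- The distribution of the simple random walk on `Γ` started at `o` after `n` steps:
at each step the walk moves to a uniformly random neighbour of the current vertex. -/
noncomputable def walkP {V : Type*} (Γ : SimpleGraph V) (o : V) : ℕ → V → ℝ
  | 0 => fun v => if v = o then 1 else 0
  | n + 1 => fun v =>
      ∑' w, (if Γ.Adj w v then walkP Γ o n w / ((Γ.neighborSet w).ncard : ℝ) else 0)

/-- The Shannon entropy `H(R_n)` of the simple random walk after `n` steps. -/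
noncomputable def walkEnt {V : Type*} (Γ : SimpleGraph V) (o : V) (n : ℕ) : ℝ :=
  -∑' v, walkP Γ o n v * Real.log (walkP Γ o n v)

/-- A vertex-transitive graph is unimodular if `|G_v w| = |G_w v|` for all `v, w`, where
`G_v w` is the orbit of `w` under the stabilizer of `v` in the automorphism group. -/
def GraphUnimodular {V : Type*} (Γ : SimpleGraph V) : Prop :=
  ∀ v w : V,
    {x | ∃ φ : Γ ≃g Γ, φ v = v ∧ φ w = x}.ncard =
    {x | ∃ φ : Γ ≃g Γ, φ w = w ∧ φ v = x}.ncard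

/-- The size of the orbit of `w` under the stabilizer of `v` in the automorphism group of `Γ`. -/
noncomputable def orbCard {V : Type*} (Γ : SimpleGraph V) (v w : V) : ℕ :=
  {x | ∃ φ : Γ ≃g Γ, φ v = v ∧ φ w = x}.ncard

/-- The subgroup of automorphisms of `Γ` fixing `v`. -/
def autStab {V : Type*} (Γ : SimpleGraph V) (v : V) : Subgroup (Γ ≃g Γ) :=
  MulAction.stabilizer (Γ ≃g Γ) v

theorem orbCard_eq_relIndex {V : Type*} (Γ : SimpleGraph V) (v w : V) :
    orbCard Γ v w = (autStab Γ w).relIndex (autStab Γ v) := by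
  have h := MulAction.index_stabilizer (autStab Γ v) w
  have h1 : (autStab Γ w).subgroupOf (autStab Γ v) = MulAction.stabilizer (autStab Γ v) w := rfl
  rw [Subgroup.relIndex, h1, h, orbCard]
  congr 1
  ext x
  constructor
  · rintro ⟨φ, hv, hw⟩
    exact ⟨⟨φ, hv⟩, hw⟩
  · rintro ⟨⟨φ, hv⟩, hw⟩
    exact ⟨φ, hv, hw⟩

theorem finite_setOf_walk_length {V : Type*} {Γ : SimpleGraph V} (hlf : LocFin Γ) (n : ℕ) :
    ∀ v : V, {x | ∃ p : Γ.Walk v x, p.length = n}.Finite := by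
  induction n with
  | zero =>
    intro v
    refine (Set.finite_singleton v).subset ?_
    rintro x ⟨p, hp⟩
    exact (SimpleGraph.Walk.eq_of_length_eq_zero hp).symm
  | succ n ih =>
    intro v
    refine ((hlf v).biUnion fun u _ => ih u).subset ?_
    rintro x ⟨p, hp⟩
    cases p with
    | nil => simp at hp
    | cons h q =>
      simp only [SimpleGraph.Walk.length_cons, add_left_inj] at hp
      exact Set.mem_biUnion h ⟨q, hp⟩

theorem finite_orbit {V : Type*} {Γ : SimpleGraph V} (hconn : Γ.Connected) (hlf : LocFin Γ)
    (v w : V) : {x | ∃ φ : Γ ≃g Γ, φ v = v ∧ φ w = x}.Finite := by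
  obtain ⟨p⟩ := hconn.preconnected v w
  refine (finite_setOf_walk_length hlf p.length v).subset ?_
  rintro x ⟨φ, hv, hw⟩
  exact ⟨(p.map φ.toHom).copy hv hw, by simp⟩

theorem orbCard_pos {V : Type*} {Γ : SimpleGraph V} (hconn : Γ.Connected) (hlf : LocFin Γ)
    (v w : V) : 0 < orbCard Γ v w :=
  (Set.ncard_pos (finite_orbit hconn hlf v w)).2 ⟨w, RelIso.refl _, rfl, rfl⟩

theorem orbCard_map {V : Type*} {Γ : SimpleGraph V} (φ : Γ ≃g Γ) (v w : V) :
    orbCard Γ (φ v) (φ w) = orbCard Γ v w := by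
  have h : {x | ∃ ψ : Γ ≃g Γ, ψ (φ v) = φ v ∧ ψ (φ w) = x} =
      φ '' {x | ∃ ψ : Γ ≃g Γ, ψ v = v ∧ ψ w = x} := by
    ext x
    constructor
    · rintro ⟨ψ, hv, rfl⟩
      exact ⟨_, ⟨(φ.trans ψ).trans φ.symm, by simp [hv], rfl⟩, by simp⟩
    · rintro ⟨_, ⟨ψ, hv, rfl⟩, rfl⟩
      exact ⟨(φ.symm.trans ψ).trans φ, by simp [hv], by simp⟩
  rw [orbCard, h, Set.ncard_image_of_injective _ φ.injective, orbCard]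

theorem Subgroup.relIndex_cocycle {G : Type*} [Group G] (A B C : Subgroup G)
    (hAB : A.relIndex B ≠ 0) (hBC : B.relIndex C ≠ 0) (hCA : C.relIndex A ≠ 0) :
    A.relIndex B * B.relIndex C * C.relIndex A =
      B.relIndex A * C.relIndex B * A.relIndex C := by
  have hx : C.relIndex (A ⊓ B) * A.relIndex B = A.relIndex (B ⊓ C) * C.relIndex B := by
    rw [Subgroup.relIndex_inf_mul_relIndex, inf_comm B C, Subgroup.relIndex_inf_mul_relIndex,
      inf_comm]
  have hy : A.relIndex (B ⊓ C) * B.relIndex C = B.relIndex (C ⊓ A) * A.relIndex C := by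
    rw [Subgroup.relIndex_inf_mul_relIndex, inf_comm C A, Subgroup.relIndex_inf_mul_relIndex,
      inf_comm]
  have hz : B.relIndex (C ⊓ A) * C.relIndex A = C.relIndex (A ⊓ B) * B.relIndex A := by
    rw [Subgroup.relIndex_inf_mul_relIndex, inf_comm A B, Subgroup.relIndex_inf_mul_relIndex,
      inf_comm]
  have hx0 : C.relIndex (A ⊓ B) ≠ 0 := mt (Subgroup.relIndex_eq_zero_of_le_right inf_le_left) hCA
  have hy0 : A.relIndex (B ⊓ C) ≠ 0 := mt (Subgroup.relIndex_eq_zero_of_le_right inf_le_left) hAB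
  have hz0 : B.relIndex (C ⊓ A) ≠ 0 := mt (Subgroup.relIndex_eq_zero_of_le_right inf_le_left) hBC
  apply Nat.eq_of_mul_eq_mul_left (Nat.pos_of_ne_zero (mul_ne_zero (mul_ne_zero hx0 hy0) hz0))
  calc _ = (C.relIndex (A ⊓ B) * A.relIndex B) * (A.relIndex (B ⊓ C) * B.relIndex C) *
        (B.relIndex (C ⊓ A) * C.relIndex A) := by ring
    _ = _ := by rw [hx, hy, hz]; ring

theorem orbCard_cocycle {V : Type*} {Γ : SimpleGraph V} (hconn : Γ.Connected) (hlf : LocFin Γ)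
    (u v w : V) : orbCard Γ u v * orbCard Γ v w * orbCard Γ w u =
      orbCard Γ v u * orbCard Γ w v * orbCard Γ u w := by
  have h := Subgroup.relIndex_cocycle (autStab Γ u) (autStab Γ v) (autStab Γ w)
  simp only [← orbCard_eq_relIndex] at h
  exact (h (orbCard_pos hconn hlf _ _).ne' (orbCard_pos hconn hlf _ _).ne'
    (orbCard_pos hconn hlf _ _).ne').symm

/-- `(w, o)` and `(o, w')` lie in the same diagonal orbit of the automorphism group. -/
def RevOrbit {V : Type*} (Γ : SimpleGraph V) (o w w' : V) : Prop :=
  ∃ φ : Γ ≃g Γ, φ w = o ∧ φ o = w'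

theorem RevOrbit.symm {V : Type*} {Γ : SimpleGraph V} {o w w' : V} (h : RevOrbit Γ o w w') :
    RevOrbit Γ o w' w := by
  obtain ⟨φ, rfl, rfl⟩ := h
  exact ⟨φ.symm, by simp, by simp⟩

theorem RevOrbit.orbCard_eq {V : Type*} {Γ : SimpleGraph V} {o w w' : V}
    (h : RevOrbit Γ o w w') : orbCard Γ o w' = orbCard Γ w o := by
  obtain ⟨φ, h1, h2⟩ := h
  rw [← orbCard_map φ w o, h1, h2]

theorem RevOrbit.adj {V : Type*} {Γ : SimpleGraph V} {o w w' : V}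
    (h : RevOrbit Γ o w w') (hw : Γ.Adj o w) : Γ.Adj o w' := by
  obtain ⟨φ, h1, h2⟩ := h
  rw [← h1, ← h2]
  exact φ.map_rel_iff.2 hw.symm

theorem ncard_revOrbit {V : Type*} {Γ : SimpleGraph V} (htrans : VertexTransitive Γ) (o w : V) :
    {w' | RevOrbit Γ o w w'}.ncard = orbCard Γ w o := by
  obtain ⟨φ, hφ⟩ := htrans w o
  have h : {w' | RevOrbit Γ o w w'} = φ '' {x | ∃ ψ : Γ ≃g Γ, ψ w = w ∧ ψ o = x} := by
    ext x
    constructor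
    · rintro ⟨ψ, h1, rfl⟩
      exact ⟨_, ⟨ψ.trans φ.symm, by simp [h1, ← hφ], rfl⟩, by simp⟩
    · rintro ⟨_, ⟨ψ, h1, rfl⟩, rfl⟩
      exact ⟨ψ.trans φ, by simp [h1, hφ], by simp⟩
  rw [h, Set.ncard_image_of_injective _ φ.injective, orbCard]

theorem card_filter_revOrbit {V : Type*} {Γ : SimpleGraph V} (hlf : LocFin Γ)
    (htrans : VertexTransitive Γ) {o w : V} (hw : Γ.Adj o w) :
    ((hlf o).toFinset.filter (RevOrbit Γ o w)).card = orbCard Γ w o := by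
  rw [← ncard_revOrbit htrans, ← Set.ncard_coe_finset]
  congr 1
  ext x
  simpa using fun h : RevOrbit Γ o w x => h.adj hw

theorem card_filter_orbit {V : Type*} {Γ : SimpleGraph V} (hlf : LocFin Γ) {o w : V}
    (hw : Γ.Adj o w) :
    ((hlf o).toFinset.filter fun x => ∃ φ : Γ ≃g Γ, φ o = o ∧ φ w = x).card = orbCard Γ o w := by
  rw [orbCard, ← Set.ncard_coe_finset]
  congr 1
  ext x
  simp only [Finset.coe_filter, Set.Finite.mem_toFinset, SimpleGraph.mem_neighborSet,
    Set.mem_ofPred_eq, and_iff_right_iff_imp]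
  rintro ⟨φ, h1, rfl⟩
  rw [← h1]
  exact φ.map_rel_iff.2 hw

/-- The mass transport identity for the modular function. -/
theorem sum_orbCard_div {V : Type*} {Γ : SimpleGraph V} (hconn : Γ.Connected) (hlf : LocFin Γ)
    (htrans : VertexTransitive Γ) (o : V) :
    ∑ w ∈ (hlf o).toFinset, (orbCard Γ w o : ℝ) / orbCard Γ o w = (hlf o).toFinset.card := by
  have hpos : ∀ v w, (orbCard Γ v w : ℝ) ≠ 0 := fun v w =>
    Nat.cast_ne_zero.2 (orbCard_pos hconn hlf v w).ne'
  calc _ = ∑ w ∈ (hlf o).toFinset, ∑ w' ∈ (hlf o).toFinset,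
        if RevOrbit Γ o w w' then (1 : ℝ) / orbCard Γ o w else 0 := by
        refine Finset.sum_congr rfl fun w hw => ?_
        rw [← Finset.sum_filter, Finset.sum_const,
          card_filter_revOrbit hlf htrans (by simpa using hw), nsmul_eq_mul, mul_one_div]
    _ = ∑ w' ∈ (hlf o).toFinset, ∑ w ∈ (hlf o).toFinset,
        if RevOrbit Γ o w' w then (1 : ℝ) / orbCard Γ w' o else 0 := by
        rw [Finset.sum_comm]
        refine Finset.sum_congr rfl fun w' _ => Finset.sum_congr rfl fun w _ => ?_
        by_cases h : RevOrbit Γ o w w'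
        · rw [if_pos h, if_pos h.symm, h.symm.orbCard_eq]
        · rw [if_neg h, if_neg fun h' => h h'.symm]
    _ = ∑ w' ∈ (hlf o).toFinset, 1 := by
        refine Finset.sum_congr rfl fun w hw => ?_
        rw [← Finset.sum_filter, Finset.sum_const,
          card_filter_revOrbit hlf htrans (by simpa using hw), nsmul_eq_mul, mul_one_div, div_self (hpos _ _)]
    _ = _ := by simp

theorem le_sum_orbCard_div {V : Type*} {Γ : SimpleGraph V} (hlf : LocFin Γ)
    (htrans : VertexTransitive Γ) {o w : V} (hw : Γ.Adj o w)
    (hne : orbCard Γ o w ≠ orbCard Γ w o) (F : ℝ → ℝ) (hF : ∀ x, 0 ≤ F x) :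
    orbCard Γ o w * F (orbCard Γ w o / orbCard Γ o w) +
      orbCard Γ w o * F (orbCard Γ o w / orbCard Γ w o) ≤
      ∑ x ∈ (hlf o).toFinset, F (orbCard Γ x o / orbCard Γ o x) := by
  set N := (hlf o).toFinset
  set A := N.filter fun x => ∃ φ : Γ ≃g Γ, φ o = o ∧ φ w = x
  set B := N.filter (RevOrbit Γ o w)
  have hA : ∀ x ∈ A, orbCard Γ x o = orbCard Γ w o ∧ orbCard Γ o x = orbCard Γ o w := by
    intro x hx
    obtain ⟨φ, h1, rfl⟩ := (Finset.mem_filter.1 hx).2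
    rw [← orbCard_map φ w o, ← orbCard_map φ o w, h1]
    exact ⟨rfl, rfl⟩
  have hB : ∀ x ∈ B, orbCard Γ x o = orbCard Γ o w ∧ orbCard Γ o x = orbCard Γ w o := by
    intro x hx
    have h := (Finset.mem_filter.1 hx).2
    exact ⟨h.symm.orbCard_eq.symm, h.orbCard_eq⟩
  have hdisj : Disjoint A B := Finset.disjoint_left.2 fun x h1 h2 =>
    hne ((hA x h1).2.symm.trans (hB x h2).2)
  calc _ = ∑ x ∈ A ∪ B, F (orbCard Γ x o / orbCard Γ o x) := by
        rw [Finset.sum_union hdisj,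
          Finset.sum_congr rfl fun x hx => by rw [(hA x hx).1, (hA x hx).2],
          Finset.sum_congr (s₁ := B) rfl fun x hx => by rw [(hB x hx).1, (hB x hx).2],
          Finset.sum_const, Finset.sum_const, nsmul_eq_mul, nsmul_eq_mul, card_filter_orbit hlf hw,
          card_filter_revOrbit hlf htrans hw]
    _ ≤ _ := Finset.sum_le_sum_of_subset_of_nonneg
        (Finset.union_subset (Finset.filter_subset _ _) (Finset.filter_subset _ _))
        fun _ _ _ => hF _

theorem sum_sqrt_orbCard_sq_add_one_le {V : Type*} {Γ : SimpleGraph V} (hconn : Γ.Connected)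
    (hlf : LocFin Γ) (htrans : VertexTransitive Γ) {o w : V} (hw : Γ.Adj o w)
    (hne : orbCard Γ o w ≠ orbCard Γ w o) :
    (∑ x ∈ (hlf o).toFinset, √((orbCard Γ x o : ℝ) / orbCard Γ o x)) ^ 2 + 1 ≤
      ((hlf o).toFinset.card : ℝ) ^ 2 := by
  set S := ∑ x ∈ (hlf o).toFinset, √((orbCard Γ x o : ℝ) / orbCard Γ o x) with hS
  set D : ℝ := ((hlf o).toFinset.card : ℝ)
  have hsum := sum_orbCard_div hconn hlf htrans o
  have hsq : ∀ ε : ℝ, ε ^ 2 = 1 → ∑ x ∈ (hlf o).toFinset,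
      (1 + ε * √((orbCard Γ x o : ℝ) / orbCard Γ o x)) ^ 2 = 2 * (D + ε * S) := by
    intro ε hε
    have : ∀ x, (1 + ε * √((orbCard Γ x o : ℝ) / orbCard Γ o x)) ^ 2 =
        1 + 2 * ε * √((orbCard Γ x o : ℝ) / orbCard Γ o x) + orbCard Γ x o / orbCard Γ o x := by
      intro x
      have := Real.sq_sqrt (show (0 : ℝ) ≤ (orbCard Γ x o : ℝ) / orbCard Γ o x by positivity)
      linear_combination √((orbCard Γ x o : ℝ) / orbCard Γ o x) ^ 2 * hε + this
    simp only [this, Finset.sum_add_distrib, hsum, ← Finset.mul_sum, ← hS]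
    simp only [Finset.sum_const, nsmul_eq_mul, mul_one]
    change D + _ + D = _
    ring
  have hle : ∀ ε : ℝ, ε ^ 2 = 1 →
      (√(orbCard Γ o w) + ε * √(orbCard Γ w o)) ^ 2 ≤ D + ε * S := by
    intro ε hε
    have h := le_sum_orbCard_div hlf htrans hw hne (fun r => (1 + ε * √r) ^ 2)
      fun _ => sq_nonneg _
    have ha : (0 : ℝ) < orbCard Γ o w := Nat.cast_pos.2 (orbCard_pos hconn hlf _ _)
    have hb : (0 : ℝ) < orbCard Γ w o := Nat.cast_pos.2 (orbCard_pos hconn hlf _ _)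
    simp only [hsq ε hε] at h
    rw [Real.sqrt_div hb.le, Real.sqrt_div ha.le] at h
    generalize (orbCard Γ o w : ℝ) = a at *
    generalize (orbCard Γ w o : ℝ) = b at *
    have hx := Real.sqrt_pos.2 ha
    have hy := Real.sqrt_pos.2 hb
    have e1 := Real.sq_sqrt ha.le
    have e2 := Real.sq_sqrt hb.le
    generalize √a = x at *
    generalize √b = y at *
    subst e1 e2
    have f1 : x ^ 2 * (1 + ε * (y / x)) ^ 2 = (x + ε * y) ^ 2 := by field_simp
    have f2 : y ^ 2 * (1 + ε * (x / y)) ^ 2 = (x + ε * y) ^ 2 := by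
      have : y ^ 2 * (1 + ε * (x / y)) ^ 2 = (y + ε * x) ^ 2 := by field_simp
      rw [this]
      linear_combination (x ^ 2 - y ^ 2) * hε
    linarith
  have h1 := hle 1 (by norm_num)
  have h2 := hle (-1) (by norm_num)
  have hmul := mul_le_mul h1 h2 (sq_nonneg _) ((sq_nonneg _).trans h1)
  have e1 := Real.sq_sqrt (Nat.cast_nonneg (α := ℝ) (orbCard Γ o w))
  have e2 := Real.sq_sqrt (Nat.cast_nonneg (α := ℝ) (orbCard Γ w o))
  have hone : (1 : ℝ) ≤ ((orbCard Γ o w : ℝ) - orbCard Γ w o) ^ 2 := by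
    have h : (orbCard Γ o w : ℤ) - orbCard Γ w o ≠ 0 := sub_ne_zero.2 (by exact_mod_cast hne)
    exact_mod_cast Int.add_one_le_of_lt (sq_pos_of_ne_zero h)
  have e3 : (√(orbCard Γ o w) + 1 * √(orbCard Γ w o)) ^ 2 *
      (√(orbCard Γ o w) + -1 * √(orbCard Γ w o)) ^ 2 =
      ((orbCard Γ o w : ℝ) - orbCard Γ w o) ^ 2 := by
    rw [← e1, ← e2]; simp only [Real.sqrt_sq (Real.sqrt_nonneg _)]; ring
  nlinarith

theorem exists_adj_orbCard_ne {V : Type*} {Γ : SimpleGraph V} (hconn : Γ.Connected)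
    (hlf : LocFin Γ) (htrans : VertexTransitive Γ) (hnot : ¬ GraphUnimodular Γ) (o : V) :
    ∃ w, Γ.Adj o w ∧ orbCard Γ o w ≠ orbCard Γ w o := by
  by_contra! hcon
  refine hnot fun v w => ?_
  change orbCard Γ v w = orbCard Γ w v
  have hadj : ∀ u v, Γ.Adj u v → orbCard Γ u v = orbCard Γ v u := by
    intro u v huv
    obtain ⟨φ, rfl⟩ := htrans u o
    have := hcon (φ v) (φ.map_rel_iff.2 huv)
    rwa [orbCard_map, orbCard_map] at this
  obtain ⟨p⟩ := hconn.preconnected v w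
  induction p with
  | nil => rfl
  | @cons a b c h q ih =>
    have hc := orbCard_cocycle hconn hlf a b c
    rw [hadj a b h, ih] at hc
    have := Nat.eq_of_mul_eq_mul_left
      (Nat.mul_pos (orbCard_pos hconn hlf _ _) (orbCard_pos hconn hlf _ _)) hc
    exact this.symm

/-- The square root of the modular function is an eigenfunction of the adjacency operator. -/
theorem sum_neighbor_sqrt_orbCard {V : Type*} {Γ : SimpleGraph V} (hconn : Γ.Connected)
    (hlf : LocFin Γ) (htrans : VertexTransitive Γ) (o v : V) :
    ∑ w ∈ (hlf v).toFinset, √((orbCard Γ w o : ℝ) / orbCard Γ o w) =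
      (∑ w ∈ (hlf o).toFinset, √((orbCard Γ w o : ℝ) / orbCard Γ o w)) *
        √((orbCard Γ v o : ℝ) / orbCard Γ o v) := by
  obtain ⟨φ, rfl⟩ := htrans o v
  rw [Finset.sum_mul]
  symm
  refine Finset.sum_bij (fun w _ => φ w) (fun w hw => ?_) (fun _ _ _ _ h => φ.injective h)
    (fun w hw => ?_) (fun w _ => ?_)
  · rw [Set.Finite.mem_toFinset, SimpleGraph.mem_neighborSet] at hw ⊢
    exact φ.map_rel_iff.2 hw
  · refine ⟨φ.symm w, ?_, by simp⟩
    rw [Set.Finite.mem_toFinset, SimpleGraph.mem_neighborSet] at hw ⊢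
    rw [← φ.map_rel_iff]
    simpa using hw
  · rw [← Real.sqrt_mul (by positivity)]
    congr 1
    have hpos : ∀ v w, (orbCard Γ v w : ℝ) ≠ 0 := fun v w =>
      Nat.cast_ne_zero.2 (orbCard_pos hconn hlf v w).ne'
    have hc := orbCard_cocycle hconn hlf o (φ o) (φ w)
    rw [orbCard_map, orbCard_map] at hc
    have hc' : (orbCard Γ o (φ o) : ℝ) * orbCard Γ o w * orbCard Γ (φ w) o =
      orbCard Γ (φ o) o * orbCard Γ w o * orbCard Γ o (φ w) := by exact_mod_cast hc
    rw [div_mul_div_comm, div_eq_div_iff (mul_ne_zero (hpos _ _) (hpos _ _)) (hpos _ _)]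
    linear_combination -hc'

theorem walkP_zero {V : Type*} (Γ : SimpleGraph V) (o v : V) :
    walkP Γ o 0 v = if v = o then 1 else 0 := rfl

theorem walkP_succ_eq_tsum {V : Type*} (Γ : SimpleGraph V) (o : V) (n : ℕ) (v : V) :
    walkP Γ o (n + 1) v =
      ∑' w, (if Γ.Adj w v then walkP Γ o n w / ((Γ.neighborSet w).ncard : ℝ) else 0) := rfl

theorem walkP_succ {V : Type*} {Γ : SimpleGraph V} (hlf : LocFin Γ) {d : ℕ}
    (hreg : ∀ v, (Γ.neighborSet v).ncard = d) (o : V) (n : ℕ) (v : V) :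
    walkP Γ o (n + 1) v = (∑ w ∈ (hlf v).toFinset, walkP Γ o n w) / d := by
  rw [walkP_succ_eq_tsum, tsum_eq_sum (s := (hlf v).toFinset), Finset.sum_div]
  · refine Finset.sum_congr rfl fun w hw => ?_
    rw [if_pos (by simpa using SimpleGraph.Adj.symm (by simpa using hw)), hreg]
  · intro w hw
    exact if_neg fun h => hw (by simpa using h.symm)

theorem walkP_nonneg {V : Type*} {Γ : SimpleGraph V} (o : V) (n : ℕ) (v : V) :
    0 ≤ walkP Γ o n v := by
  induction n generalizing v with
  | zero => rw [walkP_zero]; split_ifs <;> norm_num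
  | succ n ih =>
    rw [walkP_succ_eq_tsum]
    refine tsum_nonneg fun w => ?_
    split_ifs
    · exact div_nonneg (ih w) (Nat.cast_nonneg _)
    · exact le_rfl

theorem finite_support_walkP {V : Type*} {Γ : SimpleGraph V} (hlf : LocFin Γ) (o : V) (n : ℕ) :
    (Function.support (walkP Γ o n)).Finite := by
  induction n with
  | zero =>
    refine (Set.finite_singleton o).subset fun v hv => ?_
    by_contra h
    exact hv (if_neg h)
  | succ n ih =>
    refine (ih.biUnion fun w _ => hlf w).subset fun v hv => ?_
    by_contra h
    simp only [Set.mem_iUnion, not_exists] at h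
    refine hv ?_
    rw [walkP_succ_eq_tsum]
    refine (tsum_congr fun w => ?_).trans tsum_zero
    split_ifs with hadj
    · have hw : walkP Γ o n w = 0 := by
        by_contra h0
        exact h w h0 hadj
      rw [hw, zero_div]
    · rfl

/-- The set of possible positions of the walk after `n` steps. -/
noncomputable def walkSupp {V : Type*} {Γ : SimpleGraph V} (hlf : LocFin Γ) (o : V) (n : ℕ) :
    Finset V := (finite_support_walkP hlf o n).toFinset

theorem walkP_eq_zero {V : Type*} {Γ : SimpleGraph V} (hlf : LocFin Γ) {o : V} {n : ℕ} {v : V}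
    (h : v ∉ walkSupp hlf o n) : walkP Γ o n v = 0 := by
  simpa [walkSupp] using h

theorem sum_walkP_succ_mul {V : Type*} {Γ : SimpleGraph V} (hlf : LocFin Γ) {d : ℕ}
    (hreg : ∀ v, (Γ.neighborSet v).ncard = d) (o : V) (n : ℕ) (g : V → ℝ) :
    ∑ v ∈ walkSupp hlf o (n + 1), walkP Γ o (n + 1) v * g v =
      ∑ w ∈ walkSupp hlf o n, walkP Γ o n w * ((∑ v ∈ (hlf w).toFinset, g v) / d) := by
  set B := walkSupp hlf o (n + 1) ∪ (walkSupp hlf o n).biUnion fun w => (hlf w).toFinset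
  have hstep : ∀ v, walkP Γ o (n + 1) v =
      ∑ w ∈ walkSupp hlf o n, if Γ.Adj w v then walkP Γ o n w / d else 0 := by
    intro v
    rw [walkP_succ_eq_tsum, tsum_eq_sum (s := walkSupp hlf o n)]
    · simp only [hreg]
    · intro w hw
      rw [walkP_eq_zero hlf hw, zero_div, ite_self]
  calc _ = ∑ v ∈ B, walkP Γ o (n + 1) v * g v :=
        Finset.sum_subset Finset.subset_union_left fun v _ hv => by
          rw [walkP_eq_zero hlf hv, zero_mul]
    _ = ∑ v ∈ B, ∑ w ∈ walkSupp hlf o n,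
        if Γ.Adj w v then walkP Γ o n w / d * g v else 0 := by
        refine Finset.sum_congr rfl fun v _ => ?_
        rw [hstep, Finset.sum_mul]
        refine Finset.sum_congr rfl fun w _ => ?_
        rw [ite_mul, zero_mul]
    _ = _ := by
        rw [Finset.sum_comm]
        refine Finset.sum_congr rfl fun w hw => ?_
        rw [← Finset.sum_filter, ← Finset.mul_sum]
        have : B.filter (Γ.Adj w) = (hlf w).toFinset := by
          ext x
          simp only [Finset.mem_filter, Set.Finite.mem_toFinset, SimpleGraph.mem_neighborSet,
            and_iff_right_iff_imp]
          intro h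
          exact Finset.mem_union_right _ (Finset.mem_biUnion.2 ⟨w, hw, by simpa using h⟩)
        rw [this]
        ring

theorem sum_walkP_mul_of_eigen {V : Type*} {Γ : SimpleGraph V} (hlf : LocFin Γ) {d : ℕ}
    (hreg : ∀ v, (Γ.neighborSet v).ncard = d) (o : V) {f : V → ℝ} {c : ℝ}
    (hf : ∀ v, (∑ w ∈ (hlf v).toFinset, f w) / d = c * f v) (n : ℕ) :
    ∑ v ∈ walkSupp hlf o n, walkP Γ o n v * f v = c ^ n * f o := by
  induction n with
  | zero =>
    rw [Finset.sum_eq_single o]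
    · simp [walkP]
    · intro v _ hv
      simp [walkP, hv]
    · intro h
      rw [walkP_eq_zero hlf h, zero_mul]
  | succ n ih =>
    rw [sum_walkP_succ_mul hlf hreg]
    simp only [hf, mul_left_comm _ c, ← Finset.mul_sum, ih]
    ring

theorem sum_walkP {V : Type*} {Γ : SimpleGraph V} (hlf : LocFin Γ) {d : ℕ} (hd : d ≠ 0)
    (hreg : ∀ v, (Γ.neighborSet v).ncard = d) (o : V) (n : ℕ) :
    ∑ v ∈ walkSupp hlf o n, walkP Γ o n v = 1 := by
  have h := sum_walkP_mul_of_eigen hlf hreg o (f := fun _ => 1) (c := 1) (fun v => by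
    rw [Finset.sum_const, ← Set.ncard_eq_toFinset_card _ (hlf v), hreg]
    simp [hd]) n
  simpa using h

theorem walkP_mul_le {V : Type*} {Γ : SimpleGraph V} (hlf : LocFin Γ) {d : ℕ}
    (hreg : ∀ v, (Γ.neighborSet v).ncard = d) (o : V) {f : V → ℝ} {c : ℝ} (hf0 : ∀ v, 0 < f v)
    (hf : ∀ v, (∑ w ∈ (hlf v).toFinset, f w) / d = c * f v) (n : ℕ) (v : V) :
    walkP Γ o n v * f o ≤ c ^ n * f v := by
  induction n generalizing v with
  | zero =>
    rw [walkP_zero]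
    split_ifs with h
    · rw [h, pow_zero]
    · simpa using (hf0 v).le
  | succ n ih =>
    rw [walkP_succ hlf hreg, div_mul_eq_mul_div, Finset.sum_mul, pow_succ, mul_assoc, ← hf v,
      ← mul_div_assoc, Finset.mul_sum]
    exact div_le_div_of_nonneg_right (Finset.sum_le_sum fun w _ => ih w) (Nat.cast_nonneg d)

/-- Positive eigenfunctions of the transition operator bound the transition probabilities. -/
theorem walkP_le_pow {V : Type*} {Γ : SimpleGraph V} (hlf : LocFin Γ) {d : ℕ}
    (hreg : ∀ v, (Γ.neighborSet v).ncard = d) (o : V) {f : V → ℝ} {c : ℝ} (hf0 : ∀ v, 0 < f v)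
    (hc : 0 ≤ c) (hf : ∀ v, (∑ w ∈ (hlf v).toFinset, f w) / d = c * f v) (n : ℕ) (v : V) :
    walkP Γ o n v ≤ c ^ n := by
  have hcn : 0 ≤ c ^ n := pow_nonneg hc n
  rcases le_total (f v) (f o) with h | h
  · have h1 := walkP_mul_le hlf hreg o hf0 hf n v
    exact le_of_mul_le_mul_right (h1.trans (mul_le_mul_of_nonneg_left h hcn)) (hf0 o)
  · by_cases hv : v ∈ walkSupp hlf o n
    · have h1 : walkP Γ o n v * f v ≤ c ^ n * f o := by
        rw [← sum_walkP_mul_of_eigen hlf hreg o hf n]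
        exact Finset.single_le_sum (f := fun v => walkP Γ o n v * f v)
          (fun w _ => mul_nonneg (walkP_nonneg o n w) (hf0 w).le) hv
      exact le_of_mul_le_mul_right (h1.trans (mul_le_mul_of_nonneg_left h hcn)) (hf0 v)
    · rw [walkP_eq_zero hlf hv]
      exact hcn

theorem walkEnt_eq_sum {V : Type*} {Γ : SimpleGraph V} (hlf : LocFin Γ) {o : V} {n : ℕ}
    {s : Finset V} (hs : walkSupp hlf o n ⊆ s) :
    walkEnt Γ o n = ∑ v ∈ s, (walkP Γ o n v).negMulLog := by
  rw [walkEnt, tsum_eq_sum (s := s), ← Finset.sum_neg_distrib]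
  · simp only [Real.negMulLog, neg_mul]
  · intro v hv
    rw [walkP_eq_zero hlf fun h => hv (hs h), zero_mul]

theorem walkP_map {V : Type*} {Γ : SimpleGraph V} (φ : Γ ≃g Γ) (o : V) (n : ℕ) (v : V) :
    walkP Γ (φ o) n (φ v) = walkP Γ o n v := by
  induction n generalizing v with
  | zero => simp [walkP]
  | succ n ih =>
    rw [walkP_succ_eq_tsum, walkP_succ_eq_tsum, ← φ.toEquiv.tsum_eq]
    refine tsum_congr fun w => ?_
    have hcard : (Γ.neighborSet (φ w)).ncard = (Γ.neighborSet w).ncard := by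
      rw [← Set.ncard_image_of_injective (Γ.neighborSet w) φ.injective]
      congr 1
      ext x
      constructor
      · intro h
        exact ⟨φ.symm x, φ.map_rel_iff.1 (by simpa using h), by simp⟩
      · rintro ⟨y, hy, rfl⟩
        exact φ.map_rel_iff.2 hy
    have hadj : Γ.Adj (φ w) (φ v) ↔ Γ.Adj w v := φ.map_rel_iff
    change (if Γ.Adj (φ w) (φ v) then
      walkP Γ (φ o) n (φ w) / ((Γ.neighborSet (φ w)).ncard : ℝ) else 0) = _
    simp only [hadj, ih, hcard]

theorem walkEnt_eq {V : Type*} {Γ : SimpleGraph V} (htrans : VertexTransitive Γ) (u v : V)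
    (n : ℕ) : walkEnt Γ u n = walkEnt Γ v n := by
  obtain ⟨φ, rfl⟩ := htrans v u
  rw [walkEnt, walkEnt, ← φ.toEquiv.tsum_eq]
  congr 1
  refine tsum_congr fun w => ?_
  change walkP Γ (φ v) n (φ w) * Real.log (walkP Γ (φ v) n (φ w)) = _
  rw [walkP_map]

theorem walkP_add {V : Type*} {Γ : SimpleGraph V} (hlf : LocFin Γ) {d : ℕ}
    (hreg : ∀ v, (Γ.neighborSet v).ncard = d) (o : V) (m n : ℕ) (x : V) :
    walkP Γ o (m + n) x = ∑ v ∈ walkSupp hlf o m, walkP Γ o m v * walkP Γ v n x := by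
  induction n generalizing x with
  | zero =>
    simp only [add_zero, walkP, mul_ite, mul_one, mul_zero, Finset.sum_ite_eq]
    split_ifs with h
    · rfl
    · exact walkP_eq_zero hlf h
  | succ n ih =>
    rw [← add_assoc, walkP_succ hlf hreg]
    simp only [ih, walkP_succ hlf hreg]
    rw [Finset.sum_comm, Finset.sum_div]
    refine Finset.sum_congr rfl fun v _ => ?_
    rw [← Finset.mul_sum, mul_div_assoc]

theorem negMulLog_sum_le {ι : Type*} (s : Finset ι) (q : ι → ℝ) (hq : ∀ i ∈ s, 0 ≤ q i) :
    (∑ i ∈ s, q i).negMulLog ≤ ∑ i ∈ s, (q i).negMulLog := by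
  rw [Real.negMulLog, neg_mul, Finset.sum_mul, ← Finset.sum_neg_distrib]
  refine Finset.sum_le_sum fun i hi => ?_
  rw [Real.negMulLog, neg_mul, neg_le_neg_iff]
  rcases (hq i hi).eq_or_lt with h | h
  · simp [← h]
  · exact mul_le_mul_of_nonneg_left
      (Real.log_le_log h (Finset.single_le_sum hq hi)) h.le

theorem walkEnt_add_le {V : Type*} {Γ : SimpleGraph V} (hlf : LocFin Γ)
    (htrans : VertexTransitive Γ) {d : ℕ} (hd : d ≠ 0)
    (hreg : ∀ v, (Γ.neighborSet v).ncard = d) (o : V) (m n : ℕ) :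
    walkEnt Γ o (m + n) ≤ walkEnt Γ o m + walkEnt Γ o n := by
  set A := walkSupp hlf o m
  set C := walkSupp hlf o (m + n) ∪ A.biUnion fun v => walkSupp hlf v n
  have hC : ∀ v ∈ A, walkSupp hlf v n ⊆ C := fun v hv =>
    (Finset.subset_biUnion_of_mem (fun v => walkSupp hlf v n) hv).trans Finset.subset_union_right
  calc walkEnt Γ o (m + n) = ∑ x ∈ C, (walkP Γ o (m + n) x).negMulLog :=
        walkEnt_eq_sum hlf Finset.subset_union_left
    _ ≤ ∑ x ∈ C, ∑ v ∈ A, (walkP Γ o m v * walkP Γ v n x).negMulLog := by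
        refine Finset.sum_le_sum fun x _ => ?_
        rw [walkP_add hlf hreg]
        exact negMulLog_sum_le _ _ fun v _ => mul_nonneg (walkP_nonneg _ _ _) (walkP_nonneg _ _ _)
    _ = ∑ v ∈ A, ((walkP Γ o m v).negMulLog + walkP Γ o m v * walkEnt Γ o n) := by
        rw [Finset.sum_comm]
        refine Finset.sum_congr rfl fun v hv => ?_
        simp only [Real.negMulLog_mul]
        rw [Finset.sum_add_distrib, ← Finset.sum_mul, ← Finset.mul_sum,
          ← walkEnt_eq_sum hlf (hC v hv), walkEnt_eq htrans v o,
          ← Finset.sum_subset (hC v hv) fun x _ hx => walkP_eq_zero hlf hx,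
          sum_walkP hlf hd hreg, one_mul]
    _ = _ := by
        rw [Finset.sum_add_distrib, ← Finset.sum_mul, sum_walkP hlf hd hreg, one_mul,
          ← walkEnt_eq_sum hlf subset_rfl]

theorem le_walkEnt {V : Type*} {Γ : SimpleGraph V} (hlf : LocFin Γ) {d : ℕ} (hd : d ≠ 0)
    (hreg : ∀ v, (Γ.neighborSet v).ncard = d) (o : V) {n : ℕ} {b : ℝ}
    (hb : ∀ v, walkP Γ o n v ≤ Real.exp (-b)) : b ≤ walkEnt Γ o n := by
  rw [walkEnt_eq_sum hlf subset_rfl]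
  calc b = ∑ v ∈ walkSupp hlf o n, walkP Γ o n v * b := by
        rw [← Finset.sum_mul, sum_walkP hlf hd hreg, one_mul]
    _ ≤ _ := by
        refine Finset.sum_le_sum fun v _ => ?_
        rw [Real.negMulLog, neg_mul, ← mul_neg]
        rcases (walkP_nonneg (Γ := Γ) o n v).eq_or_lt with h | h
        · simp [← h]
        · refine mul_le_mul_of_nonneg_left ?_ h.le
          have := (Real.log_le_iff_le_exp h).2 (hb v)
          linarith

theorem stmt14 (V : Type) (Γ : SimpleGraph V) (o : V) (d : ℕ)
    (hconn : Γ.Connected) (hlf : LocFin Γ) (htrans : VertexTransitive Γ)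
    (hreg : ∀ v, (Γ.neighborSet v).ncard = d)
    (hnotuni : ¬ GraphUnimodular Γ) :
    ∃ h : ℝ,
      Filter.Tendsto (fun n : ℕ => walkEnt Γ o n / (n : ℝ)) Filter.atTop (nhds h) ∧
      -(1 / 2) * Real.log (1 - 1 / (d : ℝ) ^ 2) ≤ h ∧
      1 / (2 * (d : ℝ) ^ 2) ≤ -(1 / 2) * Real.log (1 - 1 / (d : ℝ) ^ 2) := by
  obtain ⟨w, hw, hne⟩ := exists_adj_orbCard_ne hconn hlf htrans hnotuni o
  have hcard : ∀ v, (hlf v).toFinset.card = d := fun v => by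
    rw [← Set.ncard_eq_toFinset_card _ (hlf v), hreg]
  have hkey := sum_sqrt_orbCard_sq_add_one_le hconn hlf htrans hw hne
  set f : V → ℝ := fun v => √((orbCard Γ v o : ℝ) / orbCard Γ o v)
  set S := ∑ x ∈ (hlf o).toFinset, f x
  change S ^ 2 + 1 ≤ _ at hkey
  rw [hcard] at hkey
  have hf0 : ∀ v, 0 < f v := fun v => Real.sqrt_pos.2 (div_pos
    (Nat.cast_pos.2 (orbCard_pos hconn hlf _ _)) (Nat.cast_pos.2 (orbCard_pos hconn hlf _ _)))
  have hS : 0 < S := Finset.sum_pos (fun v _ => hf0 v) ⟨w, by simpa using hw⟩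
  have hd : d ≠ 0 := by
    rintro rfl
    norm_num at hkey
    nlinarith
  have hd' : (0 : ℝ) < d := Nat.cast_pos.2 (Nat.pos_of_ne_zero hd)
  have heig : ∀ v, (∑ w ∈ (hlf v).toFinset, f w) / d = S / d * f v := fun v => by
    rw [sum_neighbor_sqrt_orbCard hconn hlf htrans o v, mul_div_right_comm]
  have hc : 0 < S / d := div_pos hS hd'
  set q : ℝ := 1 - 1 / (d : ℝ) ^ 2
  have hcq : (S / d) ^ 2 ≤ q := by
    rw [div_pow, div_le_iff₀ (by positivity)]
    simp only [q]
    field_simp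
    linarith
  have hq : 0 < q := lt_of_lt_of_le (by positivity) hcq
  have hlog : 2 * Real.log (S / d) ≤ Real.log q := by
    have := Real.log_le_log (by positivity) hcq
    rwa [Real.log_pow, Nat.cast_ofNat] at this
  have hlow : ∀ n : ℕ, n * (-(1 / 2) * Real.log q) ≤ walkEnt Γ o n := fun n => by
    refine le_walkEnt hlf hd hreg o fun v => ?_
    refine (walkP_le_pow hlf hreg o hf0 hc.le heig n v).trans ?_
    rw [← Real.exp_log (pow_pos hc n), Real.log_pow, Real.exp_le_exp]
    nlinarith [Nat.cast_nonneg (α := ℝ) n]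
  have hq1 : 1 / (2 * (d : ℝ) ^ 2) ≤ -(1 / 2) * Real.log q := by
    have h := Real.log_le_sub_one_of_pos hq
    have e : 1 / (2 * (d : ℝ) ^ 2) = -(1 / 2) * (q - 1) := by simp only [q]; field_simp; ring
    rw [e]
    linarith
  have hb : ∀ n : ℕ, n ≠ 0 → -(1 / 2) * Real.log q ≤ walkEnt Γ o n / n := fun n hn => by
    rw [le_div_iff₀ (Nat.cast_pos.2 (Nat.pos_of_ne_zero hn)), mul_comm]
    exact hlow n
  have hsub : Subadditive (walkEnt Γ o) := walkEnt_add_le hlf htrans hd hreg o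
  have hlim := hsub.tendsto_lim ⟨0, by
    rintro _ ⟨n, rfl⟩
    rcases eq_or_ne n 0 with rfl | hn
    · simp
    · exact le_trans (le_trans (by positivity) hq1) (hb n hn)⟩
  refine ⟨_, hlim, ge_of_tendsto hlim ?_, hq1⟩
  filter_upwards [Filter.eventually_ne_atTop 0] with n hn using hb n hn
end

section
/- Let Γ = (V, E) be a connected, locally finite, vertex-transitive simple graph of degree d that is NOT unimodular, and let P = (1/d)·A be the Markov operator of the simple random walk acting on ℓ²(V), where A is the adjacency operator. Then the operator norm of P satisfies ‖P‖_{ℓ²→ℓ²} ≤ √(1 − 1/d²). -/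
open scoped BigOperators Classical

/-- Schur test for a locally finite symmetric relation given by finite neighbourhoods `N`. -/
theorem schur_test {V : Type*} (N : V → Finset V) (hN : ∀ v w, w ∈ N v ↔ v ∈ N w)
    (c : V → V → ℝ) (hc : ∀ v w, 0 ≤ c v w) (hcc : ∀ v, ∀ w ∈ N v, c v w * c w v = 1)
    (K : ℝ) (hK0 : 0 ≤ K) (hK : ∀ v, ∑ w ∈ N v, c v w ≤ K)
    (f : V → ℝ) (hf : Summable fun v => f v ^ 2) :
    Summable (fun v => (∑ w ∈ N v, f w) ^ 2) ∧
      ∑' v, (∑ w ∈ N v, f w) ^ 2 ≤ K ^ 2 * ∑' v, f v ^ 2 := by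
  set F : V × V → ℝ := fun p => if p.2 ∈ N p.1 then c p.1 p.2 * f p.1 ^ 2 else 0 with hF
  have hF0 : 0 ≤ F := fun p => by
    simp only [hF, Pi.zero_apply]
    split_ifs
    · exact mul_nonneg (hc _ _) (sq_nonneg _)
    · exact le_rfl
  have hrow (w : V) : HasSum (fun v => F (w, v)) ((∑ v ∈ N w, c w v) * f w ^ 2) := by
    have h := hasSum_sum_of_ne_finset_zero (L := .unconditional V) (f := fun v => F (w, v))
      (s := N w)
      (fun v hv => by simp [hF, hv])
    rwa [Finset.sum_congr rfl (g := fun v => c w v * f w ^ 2) (fun v hv => by simp [hF, hv]),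
      ← Finset.sum_mul] at h
  have hcol (v : V) : HasSum (fun w => F (w, v)) (∑ w ∈ N v, c w v * f w ^ 2) := by
    have h := hasSum_sum_of_ne_finset_zero (L := .unconditional V) (f := fun w => F (w, v))
      (s := N v)
      (fun w hw => by simp [hF, (hN v w).not.mp hw])
    rwa [Finset.sum_congr rfl (g := fun w => c w v * f w ^ 2)
      (fun w hw => by simp [hF, (hN v w).mp hw])] at h
  have hle (w : V) : (∑ v ∈ N w, c w v) * f w ^ 2 ≤ K * f w ^ 2 :=
    mul_le_mul_of_nonneg_right (hK w) (sq_nonneg _)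
  have hrowsum : Summable fun w => (∑ v ∈ N w, c w v) * f w ^ 2 :=
    Summable.of_nonneg_of_le
      (fun w => mul_nonneg (Finset.sum_nonneg fun v _ => hc w v) (sq_nonneg _)) hle
      (hf.mul_left K)
  have hFs : Summable F := by
    refine (summable_prod_of_nonneg hF0).mpr ⟨fun w => (hrow w).summable, ?_⟩
    simpa only [(hrow _).tsum_eq] using hrowsum
  have hcolsum : Summable fun v => ∑ w ∈ N v, c w v * f w ^ 2 := by
    refine (hFs.prod_symm.prod).congr fun v => ?_
    exact (hcol v).tsum_eq
  have hcolle : ∑' v, ∑ w ∈ N v, c w v * f w ^ 2 ≤ K * ∑' w, f w ^ 2 := by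
    have h1 : ∑' v, ∑ w ∈ N v, c w v * f w ^ 2 = ∑' w, (∑ v ∈ N w, c w v) * f w ^ 2 := by
      have h := Summable.tsum_comm (f := fun w v => F (w, v)) hFs
      simpa only [(hrow _).tsum_eq, (hcol _).tsum_eq] using h
    rw [h1, ← tsum_mul_left]
    exact hrowsum.tsum_le_tsum hle (hf.mul_left K)
  have hpt (v : V) : (∑ w ∈ N v, f w) ^ 2 ≤ K * ∑ w ∈ N v, c w v * f w ^ 2 := by
    have h0 : 0 ≤ ∑ w ∈ N v, c w v * f w ^ 2 :=
      Finset.sum_nonneg fun w _ => mul_nonneg (hc w v) (sq_nonneg _)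
    refine le_trans (Finset.sum_sq_le_sum_mul_sum_of_sq_le_mul (N v) (f := fun w => c v w)
      (g := fun w => c w v * f w ^ 2) (fun w _ => hc v w)
      (fun w _ => mul_nonneg (hc w v) (sq_nonneg _)) fun w hw => ?_)
      (mul_le_mul_of_nonneg_right (hK v) h0)
    rw [← mul_assoc, hcc v w hw, one_mul]
  have hs : Summable fun v => (∑ w ∈ N v, f w) ^ 2 :=
    Summable.of_nonneg_of_le (fun _ => sq_nonneg _) hpt (hcolsum.mul_left K)
  refine ⟨hs, (hs.tsum_le_tsum hpt (hcolsum.mul_left K)).trans ?_⟩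
  rw [tsum_mul_left, pow_two, mul_assoc]
  exact mul_le_mul_of_nonneg_left hcolle hK0

/-- Lagrange's form of the variance: a lower bound on the defect in the Cauchy-Schwarz inequality
coming from two disjoint blocks on which `a` is constant. -/
theorem sq_sum_add_le_of_blocks {V : Type*} (N S T : Finset V) (hS : S ⊆ N) (hT : T ⊆ N)
    (a : V → ℝ) (x y : ℝ) (hx : ∀ w ∈ S, a w = x) (hy : ∀ w ∈ T, a w = y)
    (hxy : x ≠ y) :
    (∑ w ∈ N, a w) ^ 2 + S.card * T.card * (x - y) ^ 2 ≤ N.card * ∑ w ∈ N, a w ^ 2 := by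
  have hdouble : ∑ p ∈ N ×ˢ N, (a p.1 - a p.2) ^ 2 =
      2 * (N.card * ∑ w ∈ N, a w ^ 2) - 2 * (∑ w ∈ N, a w) ^ 2 := by
    rw [Finset.sum_product]
    simp only [sub_sq, Finset.sum_add_distrib, Finset.sum_sub_distrib, Finset.sum_const,
      nsmul_eq_mul, ← Finset.mul_sum, ← Finset.sum_mul]
    ring
  have hdisj : Disjoint (S ×ˢ T) (T ×ˢ S) := by
    rw [Finset.disjoint_left]
    rintro ⟨u, w⟩ h1 h2
    simp only [Finset.mem_product] at h1 h2
    exact hxy ((hx u h1.1).symm.trans (hy u h2.1))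
  have hsub : (S ×ˢ T) ∪ (T ×ˢ S) ⊆ N ×ˢ N :=
    Finset.union_subset (Finset.product_subset_product hS hT) (Finset.product_subset_product hT hS)
  have hle := Finset.sum_le_sum_of_subset_of_nonneg hsub
    (f := fun p => (a p.1 - a p.2) ^ 2) (fun _ _ _ => sq_nonneg _)
  rw [Finset.sum_union hdisj, hdouble] at hle
  have e1 : ∑ p ∈ S ×ˢ T, (a p.1 - a p.2) ^ 2 = S.card * T.card * (x - y) ^ 2 := by
    rw [Finset.sum_congr rfl (g := fun _ => (x - y) ^ 2)]
    · simp
    · intro p hp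
      rw [Finset.mem_product] at hp
      rw [hx _ hp.1, hy _ hp.2]
  have e2 : ∑ p ∈ T ×ˢ S, (a p.1 - a p.2) ^ 2 = S.card * T.card * (x - y) ^ 2 := by
    rw [Finset.sum_congr rfl (g := fun _ => (x - y) ^ 2)]
    · simp only [Finset.sum_const, Finset.card_product, nsmul_eq_mul, Nat.cast_mul]
      ring
    · intro p hp
      rw [Finset.mem_product] at hp
      rw [hx _ hp.2, hy _ hp.1]
      ring
  linarith

namespace SimpleGraph

variable {V : Type*} (Γ : SimpleGraph V)

/-- The orbit of `w` under the stabilizer of `v` in the automorphism group. -/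
def stabOrbit (v w : V) : Set V := {x | ∃ φ : Γ ≃g Γ, φ v = v ∧ φ w = x}

/-- The cardinality of the orbit of `w` under the stabilizer of `v`. -/
noncomputable def stabOrbitCard (v w : V) : ℕ := (Γ.stabOrbit v w).ncard

variable {Γ}

theorem self_mem_stabOrbit (v w : V) : w ∈ Γ.stabOrbit v w := ⟨1, rfl, rfl⟩

theorem stabOrbit_apply (φ : Γ ≃g Γ) (v w : V) :
    Γ.stabOrbit (φ v) (φ w) = φ '' Γ.stabOrbit v w := by
  ext x
  constructor
  · rintro ⟨ψ, h1, rfl⟩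
    refine ⟨φ.symm (ψ (φ w)), ⟨(φ.trans ψ).trans φ.symm, ?_, rfl⟩, by simp⟩
    simp [h1]
  · rintro ⟨y, ⟨ψ, h1, rfl⟩, rfl⟩
    exact ⟨(φ.symm.trans ψ).trans φ, by simp [h1], by simp⟩

theorem stabOrbitCard_apply (φ : Γ ≃g Γ) (v w : V) :
    Γ.stabOrbitCard (φ v) (φ w) = Γ.stabOrbitCard v w := by
  rw [stabOrbitCard, stabOrbit_apply, Set.ncard_image_of_injective _ φ.injective, stabOrbitCard]

theorem stabOrbit_subset_neighborSet {v w : V} (h : Γ.Adj v w) :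
    Γ.stabOrbit v w ⊆ Γ.neighborSet v := by
  rintro x ⟨φ, h1, rfl⟩
  have := φ.map_adj_iff.mpr h
  rwa [h1] at this

theorem finite_stabOrbit (hlf : LocFin Γ) (hconn : Γ.Connected) (v w : V) :
    (Γ.stabOrbit v w).Finite := by
  have h : Relation.ReflTransGen Γ.Adj v w :=
    (Γ.reachable_iff_reflTransGen v w).mp (hconn.preconnected v w)
  induction h with
  | refl =>
    refine (Set.finite_singleton v).subset ?_
    rintro x ⟨φ, h1, rfl⟩
    exact h1
  | tail _ hab ih =>
    refine (ih.biUnion fun x _ => hlf x).subset ?_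
    rintro x ⟨φ, h1, rfl⟩
    exact Set.mem_biUnion ⟨φ, h1, rfl⟩ (φ.map_adj_iff.mpr hab)

theorem stabOrbitCard_pos (hlf : LocFin Γ) (hconn : Γ.Connected) (v w : V) :
    0 < Γ.stabOrbitCard v w :=
  (Set.ncard_pos (finite_stabOrbit hlf hconn v w)).mpr ⟨w, self_mem_stabOrbit v w⟩

theorem stabOrbitCard_eq_relIndex (v w : V) :
    Γ.stabOrbitCard v w =
      (MulAction.stabilizer (Γ ≃g Γ) w).relIndex (MulAction.stabilizer (Γ ≃g Γ) v) := by
  have h : (MulAction.stabilizer (Γ ≃g Γ) w).subgroupOf (MulAction.stabilizer (Γ ≃g Γ) v) =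
      MulAction.stabilizer (MulAction.stabilizer (Γ ≃g Γ) v) w := rfl
  rw [Subgroup.relIndex, h, MulAction.index_stabilizer, stabOrbitCard]
  congr 1
  ext x
  constructor
  · rintro ⟨φ, h1, h2⟩
    exact ⟨⟨φ, h1⟩, h2⟩
  · rintro ⟨⟨φ, h1⟩, h2⟩
    exact ⟨φ, h1, h2⟩

theorem _root_.Subgroup.relIndex_symm_trans {G : Type*} [Group G] {H K L : Subgroup G}
    (hKH : K.relIndex H ≠ 0) (h1 : K.relIndex H = H.relIndex K)
    (h2 : L.relIndex K = K.relIndex L) : L.relIndex H = H.relIndex L := by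
  have a1 := Subgroup.relIndex_inf_mul_relIndex L K H
  have a2 := Subgroup.relIndex_inf_mul_relIndex L H K
  have b1 := Subgroup.relIndex_inf_mul_relIndex H L K
  have b2 := Subgroup.relIndex_inf_mul_relIndex H K L
  have c1 := Subgroup.relIndex_inf_mul_relIndex K L H
  have c2 := Subgroup.relIndex_inf_mul_relIndex K H L
  have h0 : K.relIndex (L ⊓ H) ≠ 0 :=
    fun h => hKH (Subgroup.relIndex_eq_zero_of_le_right inf_le_right h)
  simp only [inf_comm K H, inf_comm K L, inf_comm H L] at *
  refine mul_left_cancel₀ h0 ?_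
  rw [c1, c2, ← a1, ← b2, h1, a2, ← h2, b1]

theorem stabOrbitCard_symm_of_adj (hlf : LocFin Γ) (hconn : Γ.Connected)
    (h : ∀ v w, Γ.Adj v w → Γ.stabOrbitCard v w = Γ.stabOrbitCard w v) (v w : V) :
    Γ.stabOrbitCard v w = Γ.stabOrbitCard w v := by
  have hr : Relation.ReflTransGen Γ.Adj v w :=
    (Γ.reachable_iff_reflTransGen v w).mp (hconn.preconnected v w)
  induction hr with
  | refl => rfl
  | @tail a b _ hab ih =>
    have h0 := (stabOrbitCard_pos hlf hconn v a).ne'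
    have hab' := h a b hab
    rw [stabOrbitCard_eq_relIndex] at h0
    rw [stabOrbitCard_eq_relIndex, stabOrbitCard_eq_relIndex] at ih hab' ⊢
    exact Subgroup.relIndex_symm_trans h0 ih hab'

theorem exists_adj_stabOrbitCard_ne (hlf : LocFin Γ) (hconn : Γ.Connected)
    (htrans : VertexTransitive Γ) (hnu : ¬ GraphUnimodular Γ) (v : V) :
    ∃ w, Γ.Adj v w ∧ Γ.stabOrbitCard v w ≠ Γ.stabOrbitCard w v := by
  by_contra! hcon
  refine hnu (stabOrbitCard_symm_of_adj hlf hconn fun a b hab => ?_)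
  obtain ⟨φ, rfl⟩ := htrans v a
  obtain ⟨b, rfl⟩ := φ.surjective b
  rw [stabOrbitCard_apply, stabOrbitCard_apply]
  exact hcon b (φ.map_adj_iff.mp hab)

/-- `u` lies in the orbit paired with the orbit of `w` when `(w, v)` and `(v, u)` are in the same
orbit of the automorphism group. -/
def PairedOrbit (Γ : SimpleGraph V) (v w u : V) : Prop := ∃ φ : Γ ≃g Γ, φ w = v ∧ φ v = u

theorem PairedOrbit.symm {v w u : V} (h : Γ.PairedOrbit v w u) : Γ.PairedOrbit v u w := by
  obtain ⟨φ, h1, h2⟩ := h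
  exact ⟨φ.symm, by simp [← h2], by simp [← h1]⟩

theorem PairedOrbit.card_eq {v w u : V} (h : Γ.PairedOrbit v w u) :
    Γ.stabOrbitCard v u = Γ.stabOrbitCard w v := by
  obtain ⟨φ, h1, h2⟩ := h
  rw [← stabOrbitCard_apply φ w v, h1, h2]

theorem exists_pairedOrbit (htrans : VertexTransitive Γ) (v w : V) :
    ∃ u, Γ.PairedOrbit v w u := by
  obtain ⟨φ, h⟩ := htrans w v
  exact ⟨φ v, φ, h, rfl⟩

theorem PairedOrbit.card_eq' {v w u : V} (h : Γ.PairedOrbit v w u) :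
    Γ.stabOrbitCard u v = Γ.stabOrbitCard v w :=
  h.symm.card_eq.symm

theorem PairedOrbit.setOf_eq {v w u : V} (h : Γ.PairedOrbit v w u) :
    {x | Γ.PairedOrbit v w x} = Γ.stabOrbit v u := by
  obtain ⟨φ, h1, h2⟩ := h
  ext x
  constructor
  · rintro ⟨ψ, h3, h4⟩
    exact ⟨φ.symm.trans ψ, by simp [← h1, h3], by simp [← h2, h4]⟩
  · rintro ⟨ψ, h3, h4⟩
    exact ⟨φ.trans ψ, by simp [h1, h3], by simp [h2, h4]⟩

theorem PairedOrbit.adj {v w u : V} (h : Γ.PairedOrbit v w u) (hw : Γ.Adj v w) : Γ.Adj v u := by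
  obtain ⟨φ, h1, h2⟩ := h
  have := φ.map_adj_iff.mpr hw.symm
  rwa [h1, h2] at this

/-- The mass transport principle for the neighbours of a vertex. -/
theorem sum_stabOrbitCard_div (hlf : LocFin Γ) (hconn : Γ.Connected)
    (htrans : VertexTransitive Γ) (v : V) :
    ∑ w ∈ (hlf v).toFinset, (Γ.stabOrbitCard w v : ℝ) / Γ.stabOrbitCard v w =
      (hlf v).toFinset.card := by
  have hmem (w : V) : w ∈ (hlf v).toFinset ↔ Γ.Adj v w := by simp
  have hcard (w : V) (hw : Γ.Adj v w) :
      ((hlf v).toFinset.filter fun u => Γ.PairedOrbit v w u).card = Γ.stabOrbitCard w v := by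
    obtain ⟨u, hu⟩ := exists_pairedOrbit htrans v w
    rw [← hu.card_eq, stabOrbitCard, ← hu.setOf_eq, ← Set.ncard_coe_finset]
    congr 1
    ext x
    simp only [Finset.coe_filter, Set.mem_ofPred_eq, hmem]
    exact ⟨fun h => h.2, fun h => ⟨h.adj hw, h⟩⟩
  calc ∑ w ∈ (hlf v).toFinset, (Γ.stabOrbitCard w v : ℝ) / Γ.stabOrbitCard v w
      = ∑ w ∈ (hlf v).toFinset, ∑ u ∈ (hlf v).toFinset,
          if Γ.PairedOrbit v w u then (1 : ℝ) / Γ.stabOrbitCard v w else 0 := by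
        refine Finset.sum_congr rfl fun w hw => ?_
        rw [← Finset.sum_filter, Finset.sum_const, hcard w ((hmem w).mp hw), nsmul_eq_mul,
          mul_one_div]
    _ = ∑ u ∈ (hlf v).toFinset, ∑ w ∈ (hlf v).toFinset,
          if Γ.PairedOrbit v u w then (1 : ℝ) / Γ.stabOrbitCard u v else 0 := by
        rw [Finset.sum_comm]
        refine Finset.sum_congr rfl fun u _ => Finset.sum_congr rfl fun w _ => ?_
        by_cases h : Γ.PairedOrbit v u w
        · rw [if_pos h, if_pos h.symm, h.card_eq]
        · rw [if_neg h, if_neg fun h' => h h'.symm]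
    _ = ∑ u ∈ (hlf v).toFinset, (1 : ℝ) := by
        refine Finset.sum_congr rfl fun u hu => ?_
        rw [← Finset.sum_filter, Finset.sum_const, hcard u ((hmem u).mp hu), nsmul_eq_mul,
          mul_one_div, div_self]
        exact_mod_cast (stabOrbitCard_pos hlf hconn u v).ne'
    _ = (hlf v).toFinset.card := by simp

theorem sum_sqrt_stabOrbitCard_div (hlf : LocFin Γ) (hconn : Γ.Connected)
    (htrans : VertexTransitive Γ) (hnu : ¬ GraphUnimodular Γ) (v : V) :
    (∑ w ∈ (hlf v).toFinset, √((Γ.stabOrbitCard w v : ℝ) / Γ.stabOrbitCard v w)) ^ 2 + 1 ≤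
      ((hlf v).toFinset.card : ℝ) ^ 2 := by
  obtain ⟨b, hb, hne⟩ := exists_adj_stabOrbitCard_ne hlf hconn htrans hnu v
  obtain ⟨u, hu⟩ := exists_pairedOrbit htrans v b
  set p := Γ.stabOrbitCard v b with hp
  set q := Γ.stabOrbitCard b v with hq
  have hp0 : (0 : ℝ) < p := by exact_mod_cast stabOrbitCard_pos hlf hconn v b
  have hq0 : (0 : ℝ) < q := by exact_mod_cast stabOrbitCard_pos hlf hconn b v
  have hpq : (p : ℝ) ≠ q := by exact_mod_cast hne
  have hsub {w : V} (hw : Γ.Adj v w) :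
      (finite_stabOrbit hlf hconn v w).toFinset ⊆ (hlf v).toFinset := by
    simpa using stabOrbit_subset_neighborSet hw
  have hcard (w : V) : (finite_stabOrbit hlf hconn v w).toFinset.card = Γ.stabOrbitCard v w :=
    (Set.ncard_eq_toFinset_card _ _).symm
  have hconst (w : V) : ∀ x ∈ (finite_stabOrbit hlf hconn v w).toFinset,
      √((Γ.stabOrbitCard x v : ℝ) / Γ.stabOrbitCard v x) =
        √((Γ.stabOrbitCard w v : ℝ) / Γ.stabOrbitCard v w) := by
    intro x hx
    obtain ⟨φ, h1, rfl⟩ := (Set.Finite.mem_toFinset _).mp hx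
    have e1 := stabOrbitCard_apply φ v w
    have e2 := stabOrbitCard_apply φ w v
    rw [h1] at e1 e2
    rw [e1, e2]
  have hqp : √((q : ℝ) / p) ≠ √((p : ℝ) / q) := by
    intro h
    rw [Real.sqrt_inj (by positivity) (by positivity), div_eq_div_iff hp0.ne' hq0.ne'] at h
    rcases mul_self_eq_mul_self_iff.mp h with h | h
    · exact hpq h.symm
    · linarith
  have huc : √((Γ.stabOrbitCard u v : ℝ) / Γ.stabOrbitCard v u) = √((p : ℝ) / q) := by
    rw [hu.card_eq, hu.card_eq']
  have key := sq_sum_add_le_of_blocks (hlf v).toFinset _ _ (hsub hb) (hsub (hu.adj hb))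
    (fun w => √((Γ.stabOrbitCard w v : ℝ) / Γ.stabOrbitCard v w)) _ _ (hconst b)
    (fun x hx => (hconst u x hx).trans huc) hqp
  rw [hcard, hcard, hu.card_eq, ← hp, ← hq] at key
  rw [Finset.sum_congr rfl fun w _ => Real.sq_sqrt (by positivity),
    sum_stabOrbitCard_div hlf hconn htrans v, ← pow_two] at key
  have hval : (p : ℝ) * q * (√((q : ℝ) / p) - √((p : ℝ) / q)) ^ 2 = ((p : ℝ) - q) ^ 2 := by
    have hm : √((q : ℝ) / p) * √((p : ℝ) / q) = 1 := by
      rw [← Real.sqrt_mul (by positivity), div_mul_div_cancel₀ hp0.ne', div_self hq0.ne',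
        Real.sqrt_one]
    rw [sub_sq, mul_assoc 2, hm, Real.sq_sqrt (by positivity), Real.sq_sqrt (by positivity)]
    field_simp
    ring
  have hone : (1 : ℝ) ≤ ((p : ℝ) - q) ^ 2 := by
    have h : (1 : ℤ) ≤ ((p : ℤ) - q) ^ 2 := by
      have : (p : ℤ) - q ≠ 0 := sub_ne_zero.mpr (by exact_mod_cast hne)
      have := sq_pos_of_ne_zero this
      omega
    exact_mod_cast h
  linarith

end SimpleGraph

theorem stmt17 (V : Type) (Γ : SimpleGraph V) (d : ℕ)
    (hconn : Γ.Connected) (hlf : LocFin Γ) (htrans : VertexTransitive Γ)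
    (hreg : ∀ v, (Γ.neighborSet v).ncard = d)
    (hnotuni : ¬ GraphUnimodular Γ) :
    ∀ f : V → ℝ, Summable (fun v => f v ^ 2) →
      Summable (fun v => ((1 / (d : ℝ)) * ∑' w, if Γ.Adj v w then f w else 0) ^ 2) ∧
      (∑' v, ((1 / (d : ℝ)) * ∑' w, if Γ.Adj v w then f w else 0) ^ 2) ≤
        (1 - 1 / (d : ℝ) ^ 2) * ∑' v, f v ^ 2 := by
  intro f hf
  have hsum (v : V) : ∑' w, (if Γ.Adj v w then f w else 0) = ∑ w ∈ (hlf v).toFinset, f w := by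
    rw [tsum_eq_sum (s := (hlf v).toFinset) (fun w hw => if_neg (by simpa using hw))]
    exact Finset.sum_congr rfl fun w hw => if_pos (by simpa using hw)
  have hcard (v : V) : (hlf v).toFinset.card = d := by
    rw [← hreg v, Set.ncard_eq_toFinset_card _ (hlf v)]
  have hbound (v : V) := SimpleGraph.sum_sqrt_stabOrbitCard_div hlf hconn htrans hnotuni v
  simp only [hcard] at hbound
  obtain ⟨o⟩ := hconn.nonempty
  have hd1 : (1 : ℝ) ≤ (d : ℝ) ^ 2 := by
    linarith [hbound o, sq_nonneg
      (∑ w ∈ (hlf o).toFinset, √((Γ.stabOrbitCard w o : ℝ) / Γ.stabOrbitCard o w))]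
  have hd0 : (d : ℝ) ≠ 0 := by
    rintro h
    norm_num [h] at hd1
  obtain ⟨h1, h2⟩ := schur_test (fun v => (hlf v).toFinset)
    (fun v w => by simpa using Γ.adj_comm v w)
    (fun v w => √((Γ.stabOrbitCard w v : ℝ) / Γ.stabOrbitCard v w))
    (fun v w => Real.sqrt_nonneg _)
    (fun v w _ => by
      have hp : (0 : ℝ) < Γ.stabOrbitCard v w := by exact_mod_cast SimpleGraph.stabOrbitCard_pos hlf hconn v w
      have hq : (0 : ℝ) < Γ.stabOrbitCard w v := by exact_mod_cast SimpleGraph.stabOrbitCard_pos hlf hconn w v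
      rw [← Real.sqrt_mul (by positivity), div_mul_div_cancel₀ hp.ne', div_self hq.ne',
        Real.sqrt_one])
    (√((d : ℝ) ^ 2 - 1)) (Real.sqrt_nonneg _)
    (fun v => Real.le_sqrt_of_sq_le (by linarith [hbound v])) f hf
  simp only [hsum, mul_pow]
  refine ⟨h1.mul_left _, ?_⟩
  rw [tsum_mul_left]
  refine (mul_le_mul_of_nonneg_left h2 (by positivity)).trans_eq ?_
  rw [Real.sq_sqrt (by linarith)]
  field_simp
end
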